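/- arXiv:2004.10158 — 2 statements merged into one kernel-verified Lean document; each statement's English description precedes it below -/
import Mathlib

section
/- The Causal Consistency policy holds (i.e., for all events a, b, hb(a,b) implies vis(a,b)) if and only if both (i) the Read Your Writes policy holds (for all a, b, so(a,b) implies vis(a,b)) and (ii) the visibility relation vis is transitive. -/
theorem cc_iff_ryw_and_vis_trans {E : Type*} (vis so : E → E → Prop) :
    (∀ a b, Relation.TransGen (fun a b => vis a b ∨ so a b) a b → vis a b) ↔
      ((∀ a b, so a b → vis a b) ∧ Transitive vis) := by
  constructor
  · intro h
    exact ⟨fun a b hab => h a b (.single (.inr hab)),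
      fun a b c hab hbc => h a c (.tail (.single (.inl hab)) (.inl hbc))⟩
  · rintro ⟨hso, htrans⟩ a b hab
    induction hab with
    | single h => exact h.elim id (hso _ _)
    | tail _ h ih => exact htrans ih (h.elim id (hso _ _))
end

section
/- If both the Causal Visibility policy (for all events a, b, c, hb(a,b) and vis(b,c) imply vis(a,c)) and the Read Your Writes policy (for all events a, b, so(a,b) implies vis(a,b)) hold, then the Causal Consistency policy holds: for all events a, b, hb(a,b) implies vis(a,b). -/
theorem cv_and_ryw_implies_cc {E : Type*} (vis so : E → E → Prop)
    (hCV : ∀ a b c, Relation.TransGen (fun a b => vis a b ∨ so a b) a b → vis b c → vis a c)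
    (hRYW : ∀ a b, so a b → vis a b) :
    ∀ a b, Relation.TransGen (fun a b => vis a b ∨ so a b) a b → vis a b := by
  intro a b hab
  cases hab with
  | single h => exact h.elim id (hRYW a b)
  | tail hac hcb => exact hCV a _ b hac (hcb.elim id (hRYW _ b))
end
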